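/- Let ρ be a Hermitian positive semidefinite 4×4 complex matrix of trace 1 (indexed by Fin 2 × Fin 2) satisfying Πρ = ρ, with Bloch vector s ∈ ℝ³ and correlation matrix T, and let ρ^{T₂} be its partial transpose with respect to the second factor. Then there exists a 4×4 unitary matrix W such that W ρ^{T₂} W* equals (1/2) times the 4×4 real symmetric block matrix [[T, s],[sᵀ, 1]] (top-left 3×3 block T, last column s, bottom-right entry 1), regarded as a complex matrix. In particular ρ^{T₂} and (1/2)[[T, s],[sᵀ, 1]] have the same eigenvalues. -/

import Mathlib

open Matrix Kronecker Complex ComplexOrder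

noncomputable def pauli : Fin 3 → Matrix (Fin 2) (Fin 2) ℂ :=
  ![!![0, 1; 1, 0], !![0, -I; I, 0], !![1, 0; 0, -1]]

/-- The swap operator on two qubits: `Π_{(i,j),(k,l)} = δ_{il} δ_{jk}`. -/
def swapOp : Matrix (Fin 2 × Fin 2) (Fin 2 × Fin 2) ℂ :=
  Matrix.of fun p q => if p.1 = q.2 ∧ p.2 = q.1 then 1 else 0

/-- The Pauli basis of `2 × 2` matrices: the three Pauli matrices followed by the identity. -/
noncomputable def pauliBasis : Fin 3 ⊕ Fin 1 → Matrix (Fin 2) (Fin 2) ℂ :=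
  Sum.elim pauli fun _ => 1

theorem pauliBasis_isHermitian (i : Fin 3 ⊕ Fin 1) : (pauliBasis i).IsHermitian := by
  rcases i with i | i
  · fin_cases i <;> ext a b <;> fin_cases a <;> fin_cases b <;> simp [pauliBasis, pauli]
  · exact isHermitian_one

theorem trace_pauliBasis_mul (i j : Fin 3 ⊕ Fin 1) :
    (pauliBasis i * pauliBasis j).trace = if i = j then 2 else 0 := by
  rcases i with i | i <;> rcases j with j | j <;> fin_cases i <;> fin_cases j <;>
    simp [pauliBasis, pauli, trace_fin_two] <;> norm_num

theorem isHermitian_kronecker {m n : Type*} {A : Matrix m m ℂ} {B : Matrix n n ℂ}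
    (hA : A.IsHermitian) (hB : B.IsHermitian) : (A ⊗ₖ B).IsHermitian := by
  rw [IsHermitian, conjTranspose_kronecker, hA.eq, hB.eq]

theorem trace_mul_im_eq_zero {n : Type*} [Fintype n] {A B : Matrix n n ℂ}
    (hA : A.IsHermitian) (hB : B.IsHermitian) : (A * B).trace.im = 0 := by
  rw [← Complex.conj_eq_iff_im, starRingEnd_apply, ← trace_conjTranspose, conjTranspose_mul,
    hA.eq, hB.eq, trace_mul_comm]

theorem swapOp_mul_apply (ρ : Matrix (Fin 2 × Fin 2) (Fin 2 × Fin 2) ℂ) (a b : Fin 2)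
    (q : Fin 2 × Fin 2) : (swapOp * ρ) (a, b) q = ρ (b, a) q := by
  fin_cases a <;> fin_cases b <;> simp [swapOp, mul_apply, Fintype.sum_prod_type]

theorem trace_mul_kronecker (ρ : Matrix (Fin 2 × Fin 2) (Fin 2 × Fin 2) ℂ)
    (A B : Matrix (Fin 2) (Fin 2) ℂ) :
    (ρ * (A ⊗ₖ B)).trace = ∑ a, ∑ b, ∑ c, ∑ d, ρ (a, b) (c, d) * (A c a * B d b) := by
  simp [trace, mul_apply, Fintype.sum_prod_type]

/-- The unitary whose rows are the normalized transposed Pauli basis matrices. -/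
noncomputable def pauliUnitary (e : Fin 2 × Fin 2 ≃ Fin 3 ⊕ Fin 1) :
    Matrix (Fin 2 × Fin 2) (Fin 2 × Fin 2) ℂ :=
  Matrix.of fun p q => ((√2)⁻¹ : ℝ) * pauliBasis (e p) q.2 q.1

theorem pauliUnitary_apply (e : Fin 2 × Fin 2 ≃ Fin 3 ⊕ Fin 1) (p q : Fin 2 × Fin 2) :
    pauliUnitary e p q = ((√2)⁻¹ : ℝ) * pauliBasis (e p) q.2 q.1 :=
  rfl

theorem inv_sqrt_two_mul_self : (((√2)⁻¹ : ℝ) : ℂ) * (((√2)⁻¹ : ℝ) : ℂ) = 1 / 2 := by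
  rw [← Complex.ofReal_mul, ← mul_inv, Real.mul_self_sqrt (by norm_num)]
  norm_num

theorem star_pauliUnitary_apply (e : Fin 2 × Fin 2 ≃ Fin 3 ⊕ Fin 1) (p q : Fin 2 × Fin 2) :
    star (pauliUnitary e) p q = ((√2)⁻¹ : ℝ) * pauliBasis (e q) p.1 p.2 := by
  have h := (pauliBasis_isHermitian (e q)).apply p.1 p.2
  rw [star_apply, pauliUnitary_apply, star_mul', h]
  congr 1
  exact Complex.conj_ofReal _

theorem pauliUnitary_mem_unitaryGroup (e : Fin 2 × Fin 2 ≃ Fin 3 ⊕ Fin 1) :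
    pauliUnitary e ∈ Matrix.unitaryGroup (Fin 2 × Fin 2) ℂ := by
  rw [mem_unitaryGroup_iff]
  ext p q
  have h := trace_pauliBasis_mul (e p) (e q)
  have key : (pauliUnitary e * star (pauliUnitary e)) p q
      = 1 / 2 * (pauliBasis (e p) * pauliBasis (e q)).trace := by
    rw [← inv_sqrt_two_mul_self]
    simp only [mul_apply, star_pauliUnitary_apply, pauliUnitary_apply, trace, diag_apply,
      Fintype.sum_prod_type, Fin.sum_univ_two]
    ring
  rw [key, h, one_apply]
  simp only [e.injective.eq_iff]
  split_ifs <;> norm_num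

/-- Conjugating the partial transpose of a matrix with columns symmetric under the swap
yields its Pauli coefficients. -/
theorem pauliUnitary_conj_apply {ρ : Matrix (Fin 2 × Fin 2) (Fin 2 × Fin 2) ℂ}
    (hcol : ∀ p a b, ρ p (a, b) = ρ p (b, a)) (e : Fin 2 × Fin 2 ≃ Fin 3 ⊕ Fin 1)
    (p q : Fin 2 × Fin 2) :
    (pauliUnitary e * (Matrix.of fun p q : Fin 2 × Fin 2 => ρ (p.1, q.2) (q.1, p.2)) *
        star (pauliUnitary e)) p q = 1 / 2 * (ρ * (pauliBasis (e p) ⊗ₖ pauliBasis (e q))).trace := by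
  rw [trace_mul_kronecker, ← inv_sqrt_two_mul_self]
  simp only [mul_apply, star_pauliUnitary_apply, of_apply, pauliUnitary_apply,
    Fintype.sum_prod_type, Fin.sum_univ_two, hcol _ 1 0]
  ring

theorem trace_mul_kronecker_comm {ρ : Matrix (Fin 2 × Fin 2) (Fin 2 × Fin 2) ℂ}
    (hrow : ∀ a b q, ρ (a, b) q = ρ (b, a) q) (hcol : ∀ p a b, ρ p (a, b) = ρ p (b, a))
    (A B : Matrix (Fin 2) (Fin 2) ℂ) : (ρ * (A ⊗ₖ B)).trace = (ρ * (B ⊗ₖ A)).trace := by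
  simp only [trace_mul_kronecker, Fin.sum_univ_two, hcol _ 1 0, hrow 1 0]
  ring

theorem stmt16 (ρ : Matrix (Fin 2 × Fin 2) (Fin 2 × Fin 2) ℂ)
    (hherm : ρ.IsHermitian) (hpsd : ρ.PosSemidef) (htr : ρ.trace = 1)
    (hsym : swapOp * ρ = ρ)
    (s : Fin 3 → ℝ)
    (hs : s = fun i =>
      ((ρ * (pauli i ⊗ₖ (1 : Matrix (Fin 2) (Fin 2) ℂ))).trace).re)
    (T : Matrix (Fin 3) (Fin 3) ℝ)
    (hT : T = Matrix.of fun i j => ((ρ * (pauli i ⊗ₖ pauli j)).trace).re)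
    (ρPT : Matrix (Fin 2 × Fin 2) (Fin 2 × Fin 2) ℂ)
    (hPT : ρPT = Matrix.of fun p q => ρ (p.1, q.2) (q.1, p.2)) :
    ∃ W ∈ Matrix.unitaryGroup (Fin 2 × Fin 2) ℂ,
      ∃ e : (Fin 2 × Fin 2) ≃ (Fin 3 ⊕ Fin 1),
        W * ρPT * star W
          = ((1 / 2 : ℂ)) •
            ((Matrix.fromBlocks T
                (Matrix.of fun i (_ : Fin 1) => s i)
                (Matrix.of fun (_ : Fin 1) j => s j)
                (1 : Matrix (Fin 1) (Fin 1) ℝ)).map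
              (Complex.ofReal)).submatrix e e := by
  have hrow : ∀ a b q, ρ (a, b) q = ρ (b, a) q := fun a b q => by
    rw [← swapOp_mul_apply ρ, hsym]
  have hcol : ∀ p a b, ρ p (a, b) = ρ p (b, a) := fun p a b => by
    rw [← hherm.apply, hrow, hherm.apply]
  let e : Fin 2 × Fin 2 ≃ Fin 3 ⊕ Fin 1 :=
    (finProdFinEquiv (m := 2) (n := 2)).trans (finSumFinEquiv (m := 3) (n := 1)).symm
  refine ⟨pauliUnitary e, pauliUnitary_mem_unitaryGroup e, e, ?_⟩
  ext p q
  have hreal : ((ρ * (pauliBasis (e p) ⊗ₖ pauliBasis (e q))).trace.re : ℂ)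
      = (ρ * (pauliBasis (e p) ⊗ₖ pauliBasis (e q))).trace :=
    Complex.ext rfl (trace_mul_im_eq_zero hherm
      (isHermitian_kronecker (pauliBasis_isHermitian (e p)) (pauliBasis_isHermitian (e q)))).symm
  rw [hPT, pauliUnitary_conj_apply hcol, ← hreal, Matrix.smul_apply, submatrix_apply,
    map_apply, smul_eq_mul]
  congr 2
  subst hs hT
  generalize e p = i, e q = j
  rcases i with i | i <;> rcases j with j | j
  · rfl
  · rfl
  · exact congrArg Complex.re (trace_mul_kronecker_comm hrow hcol _ _)
  · simp [pauliBasis, htr, Subsingleton.elim i j]
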